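/- Under Assumption A, for each fixed x ∈ (0,∞) the Szasz–Mirakyan operator satisfies S_m(F;x) = F(x) + m^{-1} b^S(x) + o_x(m^{-1}) as m → ∞, where b^S(x) = x f′(x)/2; equivalently, m·(S_m(F;x) − F(x)) → x f′(x)/2 as m → ∞. -/

import Mathlib

open Filter Topology

/-- The Szasz basis function `V_{k,m}(x) = e^{-mx} (mx)^k / k!`. -/
noncomputable def szaszV (m k : ℕ) (x : ℝ) : ℝ :=
  Real.exp (-(m * x)) * (m * x) ^ k / (Nat.factorial k)

/-- The Szasz–Mirakyan operator `S_m(u;x) = ∑_{k=0}^∞ u(k/m) V_{k,m}(x)`. -/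
noncomputable def szaszOp (u : ℝ → ℝ) (m : ℕ) (x : ℝ) : ℝ :=
  ∑' k : ℕ, u ((k : ℝ) / m) * szaszV m k x

/-- Poisson-type shift identity: `∑ k g(k) V_{k,m}(x) = m x ∑ g(k+1) V_{k,m}(x)`. -/
lemma hasSum_szaszV_shift {m : ℕ} {x s : ℝ} {g : ℕ → ℝ}
    (h : HasSum (fun k : ℕ => g (k + 1) * szaszV m k x) s) :
    HasSum (fun k : ℕ => (k : ℝ) * g k * szaszV m k x) (m * x * s) := by
  rw [← hasSum_nat_add_iff' 1]
  simp only [Finset.range_one, Finset.sum_singleton, Nat.cast_zero, zero_mul, sub_zero]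
  refine (h.mul_left (m * x)).congr_fun ?_
  intro k
  have h1 : ((k : ℝ) + 1) ≠ 0 := by positivity
  have h2 : (k.factorial : ℝ) ≠ 0 := by positivity
  simp only [szaszV, Nat.factorial_succ, Nat.cast_mul, Nat.cast_add, Nat.cast_one, pow_succ]
  field_simp

lemma hasSum_szaszV (m : ℕ) (x : ℝ) : HasSum (fun k : ℕ => szaszV m k x) 1 := by
  have h := (NormedSpace.expSeries_div_hasSum_exp (m * x : ℝ)).mul_left (Real.exp (-(m * x)))
  rw [← Real.exp_eq_exp_ℝ, ← Real.exp_add, neg_add_cancel, Real.exp_zero] at h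
  exact h.congr_fun fun k => by simp only [szaszV]; ring

lemma szaszV_nonneg (m k : ℕ) {x : ℝ} (hx : 0 ≤ x) : 0 ≤ szaszV m k x := by
  unfold szaszV
  positivity

lemma hasSum_descFactorial_two (m : ℕ) (x : ℝ) :
    HasSum (fun k : ℕ => (k : ℝ) * (k - 1) * szaszV m k x) ((m * x) ^ 2) := by
  have h := hasSum_szaszV_shift (g := fun k => (k : ℝ) - 1) (m := m) (x := x) (s := m * x)
    (by simpa using hasSum_szaszV_shift (g := fun _ => 1) (s := 1) (by simpa using hasSum_szaszV m x))
  simpa [sq] using h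

lemma hasSum_descFactorial_three (m : ℕ) (x : ℝ) :
    HasSum (fun k : ℕ => (k : ℝ) * ((k - 1) * (k - 2)) * szaszV m k x) ((m * x) ^ 3) := by
  have h := hasSum_szaszV_shift (g := fun k => ((k : ℝ) - 1) * (k - 2)) (m := m) (x := x)
    (s := (m * x) ^ 2)
    ((hasSum_descFactorial_two m x).congr_fun fun k => by push_cast; ring)
  rwa [← pow_succ'] at h

lemma hasSum_descFactorial_four (m : ℕ) (x : ℝ) :
    HasSum (fun k : ℕ => (k : ℝ) * ((k - 1) * (k - 2) * (k - 3)) * szaszV m k x)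
      ((m * x) ^ 4) := by
  have h := hasSum_szaszV_shift (g := fun k => ((k : ℝ) - 1) * (k - 2) * (k - 3)) (m := m) (x := x)
    (s := (m * x) ^ 3)
    ((hasSum_descFactorial_three m x).congr_fun fun k => by push_cast; ring)
  rwa [← pow_succ'] at h

lemma hasSum_mean (m : ℕ) (x : ℝ) :
    HasSum (fun k : ℕ => (k : ℝ) * szaszV m k x) (m * x) := by
  simpa using hasSum_szaszV_shift (g := fun _ => 1) (s := 1) (by simpa using hasSum_szaszV m x)

lemma hasSum_centralMoment_one {m : ℕ} (hm : m ≠ 0) (x : ℝ) :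
    HasSum (fun k : ℕ => ((k : ℝ) / m - x) * szaszV m k x) 0 := by
  have hm' : (m : ℝ) ≠ 0 := by exact_mod_cast hm
  have h := ((hasSum_mean m x).mul_left (1 / (m : ℝ))).sub ((hasSum_szaszV m x).mul_left x)
  rw [show 1 / (m : ℝ) * (m * x) - x * 1 = 0 by field_simp; ring] at h
  exact h.congr_fun fun k => by ring

lemma hasSum_centralMoment_two {m : ℕ} (hm : m ≠ 0) (x : ℝ) :
    HasSum (fun k : ℕ => ((k : ℝ) / m - x) ^ 2 * szaszV m k x) (x / m) := by
  have hm' : (m : ℝ) ≠ 0 := by exact_mod_cast hm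
  have h := (((hasSum_descFactorial_two m x).mul_left (1 / (m : ℝ) ^ 2)).add
    ((hasSum_mean m x).mul_left (1 / (m : ℝ) ^ 2 - 2 * x / m))).add
    ((hasSum_szaszV m x).mul_left (x ^ 2))
  have h' : HasSum (fun k : ℕ => ((k : ℝ) / m - x) ^ 2 * szaszV m k x) _ :=
    h.congr_fun fun k => by field_simp; ring
  convert h' using 1
  field_simp
  ring

lemma hasSum_centralMoment_four {m : ℕ} (hm : m ≠ 0) (x : ℝ) :
    HasSum (fun k : ℕ => ((k : ℝ) / m - x) ^ 4 * szaszV m k x)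
      (3 * x ^ 2 / m ^ 2 + x / m ^ 3) := by
  have hm' : (m : ℝ) ≠ 0 := by exact_mod_cast hm
  have h := (((((hasSum_descFactorial_four m x).add
    ((hasSum_descFactorial_three m x).mul_left (6 - 4 * (m * x)))).add
    ((hasSum_descFactorial_two m x).mul_left (7 - 12 * (m * x) + 6 * (m * x) ^ 2))).add
    ((hasSum_mean m x).mul_left (1 - 4 * (m * x) + 6 * (m * x) ^ 2 - 4 * (m * x) ^ 3))).add
    ((hasSum_szaszV m x).mul_left ((m * x) ^ 4))).mul_left (1 / (m : ℝ) ^ 4)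
  have h' : HasSum (fun k : ℕ => ((k : ℝ) / m - x) ^ 4 * szaszV m k x) _ :=
    h.congr_fun fun k => by field_simp; ring
  convert h' using 1
  field_simp
  ring

/-- Second-order Taylor expansion with Peano remainder. -/
lemma exists_taylor_two_peano {F f : ℝ → ℝ} {x a : ℝ}
    (hF : ∀ᶠ t in 𝓝 x, HasDerivAt F (f t) t) (hf : HasDerivAt f a x) {ε : ℝ} (hε : 0 < ε) :
    ∃ δ > 0, ∀ t, |t - x| < δ →
      |F t - F x - f x * (t - x) - a / 2 * (t - x) ^ 2| ≤ ε * (t - x) ^ 2 := by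
  have hlo := (hasDerivAt_iff_isLittleO.1 hf).def hε
  obtain ⟨δ, hδ, h⟩ := Metric.eventually_nhds_iff_ball.1 (hF.and hlo)
  refine ⟨δ, hδ, fun t ht => ?_⟩
  set G : ℝ → ℝ := fun s => F s - F x - f x * (s - x) - a / 2 * (s - x) ^ 2 with hG
  have hsub : ∀ s ∈ Set.uIcc x t, |s - x| ≤ |t - x| := fun s hs => by
    simpa [abs_sub_comm] using Set.abs_sub_left_of_mem_uIcc hs
  have hder : ∀ s ∈ Set.uIcc x t,
      HasDerivWithinAt G (f s - f x - a * (s - x)) (Set.uIcc x t) s := fun s hs => by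
    have hs' : s ∈ Metric.ball x δ := by
      rw [Metric.mem_ball, Real.dist_eq]; exact (hsub s hs).trans_lt ht
    have h1 : HasDerivAt (fun s : ℝ => s - x) 1 s := (hasDerivAt_id s).sub_const x
    have h2 := ((((h s hs').1.sub_const (F x)).sub (h1.const_mul (f x))).sub
      ((h1.pow 2).const_mul (a / 2)))
    exact (h2.congr_deriv (by push_cast; ring)).hasDerivWithinAt
  have hbd : ∀ s ∈ Set.uIcc x t, ‖f s - f x - a * (s - x)‖ ≤ ε * |t - x| := fun s hs => by
    have hs' : s ∈ Metric.ball x δ := by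
      rw [Metric.mem_ball, Real.dist_eq]; exact (hsub s hs).trans_lt ht
    have h2 := (h s hs').2
    rw [smul_eq_mul, mul_comm (s - x) a, Real.norm_eq_abs (s - x)] at h2
    exact h2.trans (mul_le_mul_of_nonneg_left (hsub s hs) hε.le)
  have := (convex_uIcc x t).norm_image_sub_le_of_norm_hasDerivWithin_le hder hbd
    Set.left_mem_uIcc Set.right_mem_uIcc
  have hGx : G x = 0 := by simp [hG]
  rw [hGx, sub_zero, Real.norm_eq_abs, Real.norm_eq_abs, mul_assoc, abs_mul_abs_self, ← sq] at this
  exact this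

/-- A function bounded on `[0,∞)` has a second-order Taylor remainder dominated by
`ε (t - x)² + C (t - x)⁴`. -/
lemma exists_taylor_two_bound {F f : ℝ → ℝ} {x a K : ℝ}
    (hF : ∀ᶠ t in 𝓝 x, HasDerivAt F (f t) t) (hf : HasDerivAt f a x) (hx : 0 ≤ x)
    (hK : ∀ t, 0 ≤ t → |F t| ≤ K) {ε : ℝ} (hε : 0 < ε) :
    ∃ C, 0 ≤ C ∧ ∀ t, 0 ≤ t → |F t - F x - f x * (t - x) - a / 2 * (t - x) ^ 2| ≤
      ε * (t - x) ^ 2 + C * (t - x) ^ 4 := by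
  obtain ⟨δ, hδ, h⟩ := exists_taylor_two_peano hF hf hε
  have hK0 : 0 ≤ K := (abs_nonneg _).trans (hK x hx)
  refine ⟨2 * K / δ ^ 4 + |f x| / δ ^ 3 + |a / 2| / δ ^ 2, by positivity, fun t ht => ?_⟩
  rcases lt_or_ge |t - x| δ with h1 | h1
  · exact (h t h1).trans (le_add_of_nonneg_right (by positivity))
  refine le_trans ?_ (le_add_of_nonneg_left (by positivity))
  have e4 : (t - x) ^ 4 = |t - x| ^ 4 := by
    rw [show (4 : ℕ) = 2 * 2 from rfl, pow_mul, pow_mul, sq_abs]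
  have hd : 0 < |t - x| := hδ.trans_le h1
  have hr : 1 ≤ |t - x| / δ := (one_le_div hδ).2 h1
  have b0 : |F t - F x| ≤ 2 * K := (norm_sub_le (F t) (F x)).trans
    ((add_le_add (hK t ht) (hK x hx)).trans_eq (two_mul K).symm)
  have b1 : 2 * K ≤ 2 * K * (|t - x| / δ) ^ 4 :=
    le_mul_of_one_le_right (by positivity) (one_le_pow₀ hr)
  have b2 : |f x| * |t - x| ≤ |f x| * |t - x| * (|t - x| / δ) ^ 3 :=
    le_mul_of_one_le_right (by positivity) (one_le_pow₀ hr)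
  have b3 : |a / 2| * |t - x| ^ 2 ≤ |a / 2| * |t - x| ^ 2 * (|t - x| / δ) ^ 2 :=
    le_mul_of_one_le_right (by positivity) (one_le_pow₀ hr)
  calc |F t - F x - f x * (t - x) - a / 2 * (t - x) ^ 2|
      ≤ |F t - F x| + |f x| * |t - x| + |a / 2| * |t - x| ^ 2 := by
        rw [← abs_mul, ← abs_pow, ← abs_mul]
        exact (norm_sub_le (F t - F x - f x * (t - x)) _).trans
          (add_le_add (norm_sub_le (F t - F x) _) le_rfl)
    _ ≤ 2 * K * (|t - x| / δ) ^ 4 + |f x| * |t - x| * (|t - x| / δ) ^ 3 +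
        |a / 2| * |t - x| ^ 2 * (|t - x| / δ) ^ 2 := by linarith
    _ = _ := by rw [e4]; field_simp

/-- Voronovskaya-type error bound from a pointwise bound on the Taylor remainder. -/
lemma abs_szaszOp_sub_le {F : ℝ → ℝ} {x a b ε C : ℝ} (hx : 0 ≤ x)
    (h : ∀ t, 0 ≤ t → |F t - F x - b * (t - x) - a / 2 * (t - x) ^ 2| ≤
      ε * (t - x) ^ 2 + C * (t - x) ^ 4) {m : ℕ} (hm : m ≠ 0) :
    |szaszOp F m x - F x - a / 2 * (x / m)| ≤
      ε * (x / m) + C * (3 * x ^ 2 / m ^ 2 + x / m ^ 3) := by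
  have hB := ((hasSum_centralMoment_two hm x).mul_left ε).add
    ((hasSum_centralMoment_four hm x).mul_left C)
  set r : ℝ → ℝ := fun t => F t - F x - b * (t - x) - a / 2 * (t - x) ^ 2 with hr
  have hle : ∀ k : ℕ, ‖r ((k : ℝ) / m) * szaszV m k x‖ ≤
      ε * (((k : ℝ) / m - x) ^ 2 * szaszV m k x) + C * (((k : ℝ) / m - x) ^ 4 * szaszV m k x) :=
    fun k => by
      have hV := szaszV_nonneg m k hx
      rw [norm_mul, Real.norm_of_nonneg hV, Real.norm_eq_abs]
      exact (mul_le_mul_of_nonneg_right (h _ (by positivity)) hV).trans_eq (by ring)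
  have hR := (Summable.of_norm_bounded hB.summable hle).hasSum
  have hS := ((hR.add ((hasSum_szaszV m x).mul_left (F x))).add
    ((hasSum_centralMoment_one hm x).mul_left b)).add
    ((hasSum_centralMoment_two hm x).mul_left (a / 2))
  have hop : szaszOp F m x = _ :=
    (hS.congr_fun (fun k => by simp only [hr]; ring) :
      HasSum (fun k : ℕ => F ((k : ℝ) / m) * szaszV m k x) _).tsum_eq
  have hb := tsum_of_norm_bounded hB hle
  rw [Real.norm_eq_abs] at hb
  rw [hop]
  convert hb using 2
  ring

/-- Under Assumption A, for each fixed `x ∈ (0,∞)`,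
`S_m(F;x) = F(x) + m⁻¹ x f'(x)/2 + o_x(m⁻¹)`, i.e.
`m (S_m(F;x) − F(x)) → x f'(x)/2` as `m → ∞`. -/
theorem szaszOp_asymptotic_bias
    (F f f' : ℝ → ℝ)
    (hcdf_mono : Monotone F) (hcdf_lim : Tendsto F atTop (𝓝 1))
    (hF_cont : Continuous F)
    (hF_deriv : ∀ x ∈ Set.Ici (0 : ℝ), HasDerivWithinAt F (f x) (Set.Ici 0) x)
    (hf_deriv : ∀ x ∈ Set.Ici (0 : ℝ), HasDerivWithinAt f (f' x) (Set.Ici 0) x)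
    (hf_cont : ContinuousOn f (Set.Ici 0)) (hf'_cont : ContinuousOn f' (Set.Ici 0))
    (hf_bdd : ∃ C, ∀ x ∈ Set.Ici (0 : ℝ), |f x| ≤ C)
    (hf'_bdd : ∃ C, ∀ x ∈ Set.Ici (0 : ℝ), |f' x| ≤ C)
    (x : ℝ) (hx : 0 < x) :
    Tendsto (fun m : ℕ => (m : ℝ) * (szaszOp F m x - F x)) atTop (𝓝 (x * f' x / 2)) := by
  have hnhds : ∀ t : ℝ, 0 < t → Set.Ici (0 : ℝ) ∈ 𝓝 t := fun t ht => Ici_mem_nhds ht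
  have hF' : ∀ᶠ t in 𝓝 x, HasDerivAt F (f t) t := by
    filter_upwards [Ioi_mem_nhds hx] with t ht
    exact (hF_deriv t (Set.mem_Ioi.1 ht).le).hasDerivAt (hnhds t ht)
  have hf'' : HasDerivAt f (f' x) x := (hf_deriv x hx.le).hasDerivAt (hnhds x hx)
  have hK : ∀ t, 0 ≤ t → |F t| ≤ |F 0| + 1 := fun t ht => by
    have h1 : F t ≤ 1 := hcdf_mono.ge_of_tendsto hcdf_lim t
    have h0 : F 0 ≤ F t := hcdf_mono ht
    rw [abs_le]
    constructor <;> linarith [neg_abs_le (F 0), abs_nonneg (F 0)]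
  rw [Metric.tendsto_atTop']
  intro η hη
  have hε : 0 < η / (2 * x) := by positivity
  obtain ⟨C, hC, h⟩ := exists_taylor_two_bound hF' hf'' hx.le hK hε
  have hlim : Tendsto (fun m : ℕ => C * (3 * x ^ 2 * (m : ℝ)⁻¹ + x * ((m : ℝ)⁻¹) ^ 2))
      atTop (𝓝 0) := by
    have h0 := tendsto_inv_atTop_nhds_zero_nat (𝕜 := ℝ)
    simpa using ((h0.const_mul (3 * x ^ 2)).add ((h0.pow 2).const_mul x)).const_mul C
  obtain ⟨N, hN⟩ := eventually_atTop.1 (hlim.eventually_lt_const (half_pos hη))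
  refine ⟨N, fun m hm => ?_⟩
  have hm0 : m ≠ 0 := by omega
  have hmpos : (0 : ℝ) < m := by exact_mod_cast Nat.pos_of_ne_zero hm0
  have hb := mul_le_mul_of_nonneg_left (abs_szaszOp_sub_le hx.le h hm0) hmpos.le
  rw [Real.dist_eq]
  calc |(m : ℝ) * (szaszOp F m x - F x) - x * f' x / 2|
      = m * |szaszOp F m x - F x - f' x / 2 * (x / m)| := by
        rw [← abs_of_pos hmpos, ← abs_mul, abs_of_pos hmpos]
        congr 1
        field_simp
    _ ≤ _ := hb
    _ = η / 2 + C * (3 * x ^ 2 * (m : ℝ)⁻¹ + x * ((m : ℝ)⁻¹) ^ 2) := by field_simp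
    _ < η / 2 + η / 2 := by linarith [hN m hm.le]
    _ = η := add_halves η
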